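/- Let X^n be an n-dimensional open nonnegatively curved Alexandrov space, Ω(0) the maximum set of its Busemann function, and A ⊂ Ω(0) any subset. Then the distance function f(x) = d(x, A) has no critical point at any x ∈ X^n − Ω(0). -/

import Mathlib

open Metric Set Filter Topology Bundle
open scoped ENNReal NNReal

noncomputable section

universe u v

/-! ### Metric geometry preliminaries: geodesics, comparison angles, Alexandrov spaces -/

/-- `γ` is a unit-speed minimizing geodesic on the interval `[a, b]`:
it realizes distances between any two of its points there. -/
def IsMinGeodesicOn {X : Type u} [MetricSpace X] (γ : ℝ → X) (a b : ℝ) : Prop :=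
  ∀ s ∈ Set.Icc a b, ∀ t ∈ Set.Icc a b, dist (γ s) (γ t) = |s - t|

/-- A geodesic metric space: any two points are joined by a minimizing geodesic. -/
def GeodesicMetricSpace (X : Type u) [MetricSpace X] : Prop :=
  ∀ x y : X, ∃ γ : ℝ → X, γ 0 = x ∧ γ (dist x y) = y ∧ IsMinGeodesicOn γ 0 (dist x y)

/-- The comparison angle `∠̃_k(p; a, b)` at `p` between `a` and `b`, computed in the model
surface of constant curvature `k` by the corresponding law of cosines. -/
noncomputable def comparisonAngle {X : Type u} [MetricSpace X] (k : ℝ) (p a b : X) : ℝ :=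
  if 0 < k then
    Real.arccos ((Real.cos (Real.sqrt k * dist a b) -
        Real.cos (Real.sqrt k * dist p a) * Real.cos (Real.sqrt k * dist p b)) /
      (Real.sin (Real.sqrt k * dist p a) * Real.sin (Real.sqrt k * dist p b)))
  else if k < 0 then
    Real.arccos ((Real.cosh (Real.sqrt (-k) * dist p a) * Real.cosh (Real.sqrt (-k) * dist p b) -
        Real.cosh (Real.sqrt (-k) * dist a b)) /
      (Real.sinh (Real.sqrt (-k) * dist p a) * Real.sinh (Real.sqrt (-k) * dist p b)))
  else
    Real.arccos ((dist p a ^ 2 + dist p b ^ 2 - dist a b ^ 2) / (2 * dist p a * dist p b))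

/-- Toponogov comparison inequality for curvature bound `k` on the subset `U`
(the quadruple condition: the three comparison angles at any point sum to at most `2π`). -/
def CurvGEOn {X : Type u} [MetricSpace X] (k : ℝ) (U : Set X) : Prop :=
  ∀ p ∈ U, ∀ a ∈ U, ∀ b ∈ U, ∀ c ∈ U, p ≠ a → p ≠ b → p ≠ c →
    comparisonAngle k p a b + comparisonAngle k p b c + comparisonAngle k p c a ≤ 2 * Real.pi

/-- Toponogov comparison inequality for curvature bound `k`, globally. -/
def CurvGE (X : Type u) [MetricSpace X] (k : ℝ) : Prop :=
  CurvGEOn k (Set.univ : Set X)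

/-- An `n`-dimensional Alexandrov space of curvature `≥ k`: a complete, locally compact
geodesic (length) space of Hausdorff dimension `n` satisfying Toponogov comparison for `k`. -/
structure IsAlexandrov (X : Type u) [MetricSpace X] (n : ℕ) (k : ℝ) : Prop where
  complete : CompleteSpace X
  locallyCompact : LocallyCompactSpace X
  geodesic : GeodesicMetricSpace X
  dim_eq : dimH (Set.univ : Set X) = (n : ℝ≥0∞)
  curv : CurvGE X k

/-- A subset is totally convex if every minimizing geodesic of the ambient space with both
endpoints in the subset lies entirely in it. -/
def TotallyConvex {X : Type u} [MetricSpace X] (S : Set X) : Prop :=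
  ∀ (γ : ℝ → X) (a b : ℝ), a ≤ b → IsMinGeodesicOn γ a b →
    γ a ∈ S → γ b ∈ S → ∀ t ∈ Set.Icc a b, γ t ∈ S

/-- A line: a complete geodesic realizing distances for all times. -/
def IsLine {X : Type u} [MetricSpace X] (γ : ℝ → X) : Prop :=
  ∀ s t : ℝ, dist (γ s) (γ t) = |s - t|

/-- A ray emanating from a point: a unit–speed minimizing geodesic defined on `[0, len]`. -/
structure GeodesicRayFrom {X : Type u} [MetricSpace X] (p : X) : Type u where
  toFun : ℝ → X
  len : ℝ
  len_pos : 0 < len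
  source : toFun 0 = p
  geodesic : IsMinGeodesicOn toFun 0 len

/-- The (upper) angle at `p` between two geodesics emanating from `p`, namely the limit of
comparison angles `∠̃_0 (p; γ₁(s), γ₂(t))` as `s, t → 0⁺`. -/
noncomputable def angleAt {X : Type u} [MetricSpace X] (p : X) (γ₁ γ₂ : ℝ → X) : ℝ :=
  Filter.limsup (fun st : ℝ × ℝ => comparisonAngle 0 p (γ₁ st.1) (γ₂ st.2))
    ((nhdsWithin (0:ℝ) (Set.Ioi 0)) ×ˢ (nhdsWithin (0:ℝ) (Set.Ioi 0)))

/-- `D` is (a realization of) the space of directions `Σ_p X`: a complete metric space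
containing the geodesic directions at `p`, with the angle metric, as a dense subset. -/
structure IsSpaceOfDirections {X : Type u} [MetricSpace X] (p : X)
    (D : Type v) [MetricSpace D] : Prop where
  complete : CompleteSpace D
  exists_param : ∃ f : GeodesicRayFrom p → D,
    (∀ γ₁ γ₂ : GeodesicRayFrom p, dist (f γ₁) (f γ₂) = angleAt p γ₁.toFun γ₂.toFun) ∧
    DenseRange f

/-- `IsIteratedDirSpace X m Y mY` : `(Y, mY)` is an `m`-fold iterated space of directions
of `X` (a space of directions of a space of directions of … of `X`, `m` times). -/
inductive IsIteratedDirSpace (X : Type u) [MetricSpace X] :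
    ℕ → ∀ (Y : Type u), MetricSpace Y → Prop
  | base (p : X) (Y : Type u) (mY : MetricSpace Y) :
      @IsSpaceOfDirections X _ p Y mY → IsIteratedDirSpace X 1 Y mY
  | step (m : ℕ) (Y : Type u) (mY : MetricSpace Y) (q : Y) (Z : Type u) (mZ : MetricSpace Z) :
      IsIteratedDirSpace X m Y mY → @IsSpaceOfDirections Y mY q Z mZ →
      IsIteratedDirSpace X (m + 1) Z mZ

/-- The unit sphere `S^d ⊆ ℝ^{d+1}`. -/
abbrev StdSphere (d : ℕ) : Type := Metric.sphere (0 : EuclideanSpace ℝ (Fin (d + 1))) 1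

/-- An `n`-dimensional space is topologically regular if all its (iterated) spaces of
directions are homeomorphic to spheres of the appropriate dimension. -/
def TopologicallyRegular (X : Type u) [MetricSpace X] (n : ℕ) : Prop :=
  ∀ m : ℕ, m ≤ n → ∀ (Y : Type u) (mY : MetricSpace Y), IsIteratedDirSpace X m Y mY →
    letI := mY
    Nonempty (Y ≃ₜ StdSphere (n - m))

/-! ### Busemann functions, boundary, and souls -/

/-- The Busemann function `b(x) = lim_{t → ∞} (d(x, ∂B(p,t)) - t)` associated to `p`. -/
noncomputable def busemann {X : Type u} [MetricSpace X] (p x : X) : ℝ :=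
  limUnder Filter.atTop (fun t : ℝ => Metric.infDist x (frontier (Metric.ball p t)) - t)

/-- The set of maximum points of a real function. -/
def maxSet {X : Type u} (f : X → ℝ) : Set X := {x | ∀ y, f y ≤ f x}

/-- The set of maximum points of `f` restricted to `C`. -/
def maxSetOn {X : Type u} (C : Set X) (f : X → ℝ) : Set X := {x ∈ C | ∀ y ∈ C, f y ≤ f x}

/-- The boundary of a (convex, finite-dimensional) subset `C` of an Alexandrov space:
the points of `C` having no relative neighborhood in `C` homeomorphic to
`ℝ^d`, `d = dim C`. -/
def AlexBoundary {X : Type u} [MetricSpace X] (C : Set X) : Set X :=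
  {x ∈ C | ¬ ∃ V : Set X, V ⊆ C ∧ x ∈ V ∧ (∃ U : Set X, IsOpen U ∧ V = U ∩ C) ∧
    Nonempty (V ≃ₜ EuclideanSpace ℝ (Fin (Nat.floor (dimH C).toReal)))}

/-- `S` is the soul of `X` constructed from the basepoint `p` via the Cheeger–Gromoll
filtration: `Ω 0` is the maximum set of the Busemann function of `p`, each `Ω (i+1)` is the
maximum set on `Ω i` of the distance to `∂(Ω i)`, all `Ω i` are compact and totally convex,
and the process stops exactly when the boundary is empty, yielding `S`. -/
def IsSoulWithBase {X : Type u} [MetricSpace X] (p : X) (S : Set X) : Prop :=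
  ∃ (k : ℕ) (Ω : ℕ → Set X),
    Ω 0 = maxSet (busemann p) ∧
    (∀ i ≤ k, IsCompact (Ω i) ∧ TotallyConvex (Ω i)) ∧
    (∀ i < k, AlexBoundary (Ω i) ≠ ∅ ∧
      Ω (i + 1) = maxSetOn (Ω i) (fun x => Metric.infDist x (AlexBoundary (Ω i)))) ∧
    AlexBoundary (Ω k) = ∅ ∧ S = Ω k

/-- `S` is a soul of `X`. -/
def IsSoul {X : Type u} [MetricSpace X] (S : Set X) : Prop :=
  ∃ p : X, IsSoulWithBase p S

/-! ### Critical points of distance functions -/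

/-- `σ` is a shortest geodesic from `x` to the set `A`. -/
def IsShortestToSet {X : Type u} [MetricSpace X] (x : X) (A : Set X)
    (σ : GeodesicRayFrom x) : Prop :=
  σ.toFun σ.len ∈ A ∧ σ.len = Metric.infDist x A

/-- `x ∉ A` is a critical point of the distance function `d(·, A)`: for every direction at
`x` there is a shortest geodesic from `x` to `A` making an angle `≤ π/2` with it. -/
def IsCriticalPt {X : Type u} [MetricSpace X] (A : Set X) (x : X) : Prop :=
  x ∉ A ∧ ∀ γ : GeodesicRayFrom x, ∃ σ : GeodesicRayFrom x,
    IsShortestToSet x A σ ∧ angleAt x γ.toFun σ.toFun ≤ Real.pi / 2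

/-! ### Intrinsic metrics, totally geodesic subsets -/

/-- The intrinsic (induced length) distance inside the subset `S`, as the infimum of the
lengths (total variations) of continuous paths in `S` joining the two points. -/
noncomputable def intrinsicDistIn {X : Type u} [MetricSpace X] (S : Set X) (x y : X) : ℝ≥0∞ :=
  ⨅ (γ : ℝ → X) (_ : ContinuousOn γ (Set.Icc (0:ℝ) 1)) (_ : γ 0 = x) (_ : γ 1 = y)
    (_ : ∀ t ∈ Set.Icc (0:ℝ) 1, γ t ∈ S), eVariationOn γ (Set.Icc (0:ℝ) 1)

/-- `S` is totally geodesic: near every point of `S`, the intrinsic distance of `S`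
agrees with the ambient distance (so geodesics of `S` are geodesics of `X`). -/
def IsTotallyGeodesicIn {X : Type u} [MetricSpace X] (S : Set X) : Prop :=
  ∀ x ∈ S, ∃ ε > (0:ℝ), ∀ y ∈ S ∩ Metric.ball x ε, ∀ z ∈ S ∩ Metric.ball x ε,
    intrinsicDistIn S y z = ENNReal.ofReal (dist y z)

/-- Toponogov comparison for nonnegative curvature with respect to an abstract distance
function `d` on the points of `S`. -/
def NonnegCurvedForDist {X : Type u} (d : X → X → ℝ) (S : Set X) : Prop :=
  ∀ p ∈ S, ∀ a ∈ S, ∀ b ∈ S, ∀ c ∈ S, p ≠ a → p ≠ b → p ≠ c →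
    Real.arccos ((d p a ^ 2 + d p b ^ 2 - d a b ^ 2) / (2 * d p a * d p b)) +
    Real.arccos ((d p b ^ 2 + d p c ^ 2 - d b c ^ 2) / (2 * d p b * d p c)) +
    Real.arccos ((d p c ^ 2 + d p a ^ 2 - d c a ^ 2) / (2 * d p c * d p a)) ≤ 2 * Real.pi

/-- `S`, with its intrinsic metric, is nonnegatively curved in the comparison sense. -/
def NonnegCurvedIntrinsic {X : Type u} [MetricSpace X] (S : Set X) : Prop :=
  NonnegCurvedForDist (fun x y => (intrinsicDistIn S x y).toReal) S

/-! ### Deformation retracts, local isometries, quotients -/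

/-- `S` is a deformation retract of `X`. -/
def IsDeformationRetract {X : Type u} [TopologicalSpace X] (S : Set X) : Prop :=
  ∃ H : C(unitInterval × X, X),
    (∀ x : X, H (0, x) = x) ∧ (∀ x : X, H (1, x) ∈ S) ∧ ∀ x ∈ S, H (1, x) = x

/-- A map which is an isometry on a neighborhood of each point. -/
def IsLocalIsometry {A : Type u} {B : Type v} [MetricSpace A] [MetricSpace B]
    (f : A → B) : Prop :=
  ∀ a : A, ∃ ε > (0:ℝ), ∀ x ∈ Metric.ball a ε, ∀ y ∈ Metric.ball a ε,
    dist (f x) (f y) = dist x y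

/-- `X` is the metric quotient of `W` by a free isometric involution `σ`. -/
def IsZ2Quotient (W : Type u) [MetricSpace W] (X : Type v) [MetricSpace X] : Prop :=
  ∃ σ : W ≃ᵢ W, (∀ w, σ (σ w) = w) ∧ (∀ w, σ w ≠ w) ∧
    ∃ pr : W → X, Function.Surjective pr ∧ (∀ w, pr (σ w) = pr w) ∧
      ∀ a b : W, dist (pr a) (pr b) = min (dist a b) (dist a (σ b))

/-- The quotient of `Y` by a subgroup `Γ` of its isometry group (as a topological space). -/
def QuotByIsoms (Y : Type u) [MetricSpace Y] (Γ : Subgroup (Y ≃ᵢ Y)) : Type u :=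
  Quot (fun a b : Y => ∃ g ∈ Γ, g a = b)

instance (Y : Type u) [MetricSpace Y] (Γ : Subgroup (Y ≃ᵢ Y)) :
    TopologicalSpace (QuotByIsoms Y Γ) := by unfold QuotByIsoms; infer_instance

/-- The subgroup `Γ` of isometries acts freely. -/
def FreeIsomSubgroup (Y : Type u) [MetricSpace Y] (Γ : Subgroup (Y ≃ᵢ Y)) : Prop :=
  ∀ g ∈ Γ, g ≠ (1 : Y ≃ᵢ Y) → ∀ y : Y, g y ≠ y

/-! ### Model spaces -/

/-- The unit circle `S¹`. -/
abbrev Circle1 : Type := Metric.sphere (0 : EuclideanSpace ℝ (Fin 2)) 1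

/-- The round 2-sphere `S²`. -/
abbrev Sphere2 : Type := Metric.sphere (0 : EuclideanSpace ℝ (Fin 3)) 1

/-- The round 3-sphere `S³`. -/
abbrev Sphere3 : Type := Metric.sphere (0 : EuclideanSpace ℝ (Fin 4)) 1

/-- The 2-torus `T²`. -/
abbrev Torus2 : Type := AddCircle (1:ℝ) × AddCircle (1:ℝ)

/-- The 3-torus `T³`. -/
abbrev Torus3 : Type := AddCircle (1:ℝ) × AddCircle (1:ℝ) × AddCircle (1:ℝ)

/-- The real projective plane `ℝP²`, as the quotient of `S²` by the antipodal map. -/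
def RP2 : Type :=
  Quot (fun x y : Sphere2 => (x : EuclideanSpace ℝ (Fin 3)) = y ∨
    (x : EuclideanSpace ℝ (Fin 3)) = -(y : EuclideanSpace ℝ (Fin 3)))
instance : TopologicalSpace RP2 := by unfold RP2; infer_instance

/-- The Klein bottle `K²`, as the quotient of `ℝ²` by the usual group of affine motions. -/
def KleinBottle : Type :=
  Quot (fun p q : ℝ × ℝ => ∃ m n : ℤ, q.1 = p.1 + m ∧ q.2 = (-1:ℝ)^m * p.2 + n)
instance : TopologicalSpace KleinBottle := by unfold KleinBottle; infer_instance

/-- `S² × S¹`. -/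
abbrev Sphere2CrossCircle : Type := Sphere2 × Circle1

/-- The closed unit 3-ball `D³`. -/
abbrev Disk3 : Type := Metric.closedBall (0 : EuclideanSpace ℝ (Fin 3)) 1

/-- The open solid Klein bottle: the total space of the nonorientable `ℝ²`-bundle
over `S¹`. An `n`-manifold is orientable iff it contains no such open subset (n = 3). -/
def SolidKleinInterior : Type :=
  Quot (fun p q : ℝ × ℝ × ℝ =>
    ∃ m : ℤ, q.1 = p.1 + m ∧ q.2.1 = (-1:ℝ)^m * p.2.1 ∧ q.2.2 = p.2.2)
instance : TopologicalSpace SolidKleinInterior := by unfold SolidKleinInterior; infer_instance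

/-- Orientability of a 3-manifold: it contains no open subset homeomorphic to the interior of
a solid Klein bottle (equivalently, no orientation-reversing loop). -/
def Orientable3Manifold (X : Type u) [TopologicalSpace X] : Prop :=
  ¬ ∃ U : Set X, IsOpen U ∧ Nonempty (U ≃ₜ SolidKleinInterior)

/-! ### Bundles -/

/-- A (topological) vector bundle over `B` with model fiber `F`, bundled as data. -/
structure VectorBundleOver (B : Type u) [TopologicalSpace B] (F : Type v)
    [NormedAddCommGroup F] [NormedSpace ℝ F] : Type (max u (v + 1)) where
  fiber : B → Type v
  [topFiber : ∀ b, TopologicalSpace (fiber b)]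
  [addFiber : ∀ b, AddCommGroup (fiber b)]
  [modFiber : ∀ b, Module ℝ (fiber b)]
  [topTotal : TopologicalSpace (Bundle.TotalSpace F fiber)]
  [isFiberBundle : FiberBundle F fiber]
  [isVectorBundle : VectorBundle ℝ F fiber]

/-- `X` is homeomorphic to the total space of a vector bundle over `B` with fiber `F`. -/
def HomeoToBundleOver (X : Type u) [TopologicalSpace X] (B : Type v) [TopologicalSpace B]
    (F : Type w) [NormedAddCommGroup F] [NormedSpace ℝ F] : Prop :=
  ∃ VB : VectorBundleOver B F,
    Nonempty (@Homeomorph (Bundle.TotalSpace F VB.fiber) X VB.topTotal _)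

/-! ### Gromov–Hausdorff convergence (pointed, via ε-approximations) -/

/-- Pointed Gromov–Hausdorff convergence of `(Xᵢ, pᵢ)` to `(Y, q)`, expressed by the
existence of `ε`-isometries on `R`-balls for every `ε, R > 0`, eventually in `i`. -/
def PGHTendsto (X : ℕ → Type u) (mX : ∀ i, MetricSpace (X i)) (pX : ∀ i, X i)
    (Y : Type v) [MetricSpace Y] (q : Y) : Prop :=
  ∀ ε > (0:ℝ), ∀ R > (0:ℝ), ∀ᶠ i in Filter.atTop,
    letI := mX i
    ∃ f : X i → Y, dist (f (pX i)) q ≤ ε ∧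
      (∀ x y : X i, dist x (pX i) < R → dist y (pX i) < R →
        |dist (f x) (f y) - dist x y| ≤ ε) ∧
      (∀ z : Y, dist z q < R → ∃ x : X i, dist x (pX i) < R + ε ∧ dist z (f x) ≤ ε)

/-! ### Spherical suspensions -/

/-- The spherical suspension distance over a metric space: the point `(s, ξ)` lies at
distance `s ∈ [0, π]` from the north pole, above the direction `ξ`. -/
noncomputable def suspDist {D : Type u} [MetricSpace D] (E : Set D) (a b : ℝ × E) : ℝ :=
  Real.arccos (Real.cos a.1 * Real.cos b.1 +
    Real.sin a.1 * Real.sin b.1 * Real.cos (min (dist a.2 b.2) Real.pi))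

/-! ### Concavity along geodesics -/

/-- `f` is concave along every minimizing geodesic of `X`. -/
def ConcaveAlongGeodesics {X : Type u} [MetricSpace X] (f : X → ℝ) : Prop :=
  ∀ (γ : ℝ → X) (a b : ℝ), a ≤ b → IsMinGeodesicOn γ a b →
    ∀ s ∈ Set.Icc a b, ∀ t ∈ Set.Icc a b, ∀ θ ∈ Set.Icc (0:ℝ) 1,
      θ * f (γ s) + (1 - θ) * f (γ t) ≤ f (γ (θ * s + (1 - θ) * t))

/-! ### Admissible maps, regular points, locally trivial bundles -/

/-- An admissible function on `U` in Perelman's sense: a smooth function of finitely many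
distance functions. -/
def AdmissibleOn {X : Type u} [MetricSpace X] (f : X → ℝ) (U : Set X) : Prop :=
  ∃ (N : ℕ) (q : Fin N → X) (φ : (Fin N → ℝ) → ℝ), ContDiff ℝ (⊤ : ℕ∞) φ ∧
    ∀ x ∈ U, f x = φ (fun i => dist x (q i))

/-- Lower directional derivative of `f` at `x` along the curve `γ` (with `γ 0 = x`). -/
noncomputable def lowerDirDeriv {X : Type u} [MetricSpace X] (f : X → ℝ) (x : X)
    (γ : ℝ → X) : ℝ :=
  Filter.liminf (fun t : ℝ => (f (γ t) - f x) / t) (nhdsWithin (0:ℝ) (Set.Ioi 0))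

/-- The map `f = (f₁, …, f_k)` is regular (noncritical) at `x`: some geodesic direction has
all directional derivatives uniformly positive. -/
def RegularAt {X : Type u} [MetricSpace X] {m : ℕ}
    (f : X → EuclideanSpace ℝ (Fin m)) (x : X) : Prop :=
  ∃ c > (0:ℝ), ∃ γ : GeodesicRayFrom x, ∀ j : Fin m,
    c ≤ lowerDirDeriv (fun y => f y j) x γ.toFun

/-- The restriction of `f` to `U` is a locally trivial fiber bundle. -/
def IsLocTrivialBundleOn {X : Type u} [TopologicalSpace X] {m : ℕ}
    (f : X → EuclideanSpace ℝ (Fin m)) (U : Set X) : Prop :=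
  ∀ x ∈ U, ∃ V : Set (EuclideanSpace ℝ (Fin m)), IsOpen V ∧ f x ∈ V ∧
    ∃ (F : Type u) (_ : TopologicalSpace F)
      (φ : (U ∩ f ⁻¹' V : Set X) ≃ₜ V × F),
      ∀ z : (U ∩ f ⁻¹' V : Set X), ((φ z).1 : EuclideanSpace ℝ (Fin m)) = f (z : X)

end

noncomputable section
universe u

namespace IsMinGeodesicOn

variable {X : Type u} [MetricSpace X] {γ : ℝ → X} {a b : ℝ}

theorem continuousOn (h : IsMinGeodesicOn γ a b) : ContinuousOn γ (Set.Icc a b) := by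
  have hL : LipschitzOnWith 1 γ (Set.Icc a b) :=
    LipschitzOnWith.of_dist_le_mul fun s hs t ht => by
      rw [h s hs t ht, Real.dist_eq, NNReal.coe_one, one_mul]
  exact hL.continuousOn

theorem dist_left (h : IsMinGeodesicOn γ a b) {t : ℝ} (ht : t ∈ Set.Icc a b) :
    dist (γ a) (γ t) = t - a := by
  rw [h a ⟨le_rfl, ht.1.trans ht.2⟩ t ht, abs_sub_comm, abs_of_nonneg (by linarith [ht.1])]

theorem dist_right (h : IsMinGeodesicOn γ a b) {t : ℝ} (ht : t ∈ Set.Icc a b) :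
    dist (γ t) (γ b) = b - t := by
  rw [h t ht b ⟨ht.1.trans ht.2, le_rfl⟩, abs_sub_comm, abs_of_nonneg (by linarith [ht.2])]

end IsMinGeodesicOn

namespace GeodesicMetricSpace

variable {X : Type u} [MetricSpace X]

/-- A point at prescribed distance from `x` on a minimizing geodesic from `x` to `y`. -/
theorem exists_between (hg : GeodesicMetricSpace X) (x y : X) {r : ℝ} (h0 : 0 ≤ r)
    (hr : r ≤ dist x y) : ∃ z, dist x z = r ∧ dist z y = dist x y - r := by
  obtain ⟨γ, h1, h2, h3⟩ := hg x y
  refine ⟨γ r, ?_, ?_⟩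
  · simpa [h1] using h3.dist_left ⟨h0, hr⟩
  · simpa [h2] using h3.dist_right ⟨h0, hr⟩

/-- **Hopf–Rinow**: closed balls of a complete locally compact geodesic space are compact. -/
theorem isCompact_closedBall (hg : GeodesicMetricSpace X) [CompleteSpace X]
    [LocallyCompactSpace X] (x : X) (r : ℝ) : IsCompact (closedBall x r) := by
  by_contra hr
  set S : Set ℝ := {s | 0 ≤ s ∧ IsCompact (closedBall x s)} with hS
  have h0 : (0 : ℝ) ∈ S := ⟨le_rfl, by simp⟩
  have hbdd : BddAbove S := by
    refine ⟨r, fun s hs => ?_⟩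
    by_contra! hlt
    exact hr (hs.2.of_isClosed_subset isClosed_closedBall (closedBall_subset_closedBall hlt.le))
  set R := sSup S with hR
  have hR0 : 0 ≤ R := le_csSup hbdd h0
  have hcpt : IsCompact (closedBall x R) := by
    refine isCompact_iff_totallyBounded_isComplete.2 ⟨?_, isClosed_closedBall.isComplete⟩
    rw [Metric.totallyBounded_iff]
    intro ε hε
    obtain ⟨s, hs, hsR⟩ := exists_lt_of_lt_csSup ⟨0, h0⟩ (show R - ε / 2 < sSup S by linarith)
    obtain ⟨t, ht, hst⟩ := Metric.totallyBounded_iff.1 hs.2.totallyBounded (ε / 2) (by linarith)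
    refine ⟨t, ht, fun z hz => ?_⟩
    obtain ⟨w, hw, hwz⟩ : ∃ w ∈ closedBall x s, dist w z < ε / 2 := by
      rcases le_total (dist x z) s with h | h
      · exact ⟨z, by simpa [dist_comm] using h, by simpa using hε⟩
      · obtain ⟨w, h1, h2⟩ := hg.exists_between x z hs.1 h
        refine ⟨w, by simp [dist_comm, h1], ?_⟩
        rw [mem_closedBall, dist_comm] at hz
        linarith
    obtain ⟨y, hy, hwy⟩ := mem_iUnion₂.1 (hst hw)
    refine mem_iUnion₂.2 ⟨y, hy, ?_⟩
    rw [mem_ball] at hwy ⊢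
    linarith [dist_triangle z w y, dist_comm w z]
  obtain ⟨δ, hδ, hδc⟩ := hcpt.exists_isCompact_cthickening
  have hmem : R + δ ∈ S := by
    refine ⟨by linarith, hδc.of_isClosed_subset isClosed_closedBall fun z hz => ?_⟩
    rw [mem_closedBall, dist_comm] at hz
    rcases le_total (dist x z) R with h | h
    · exact self_subset_cthickening _ (by simpa [dist_comm] using h)
    · obtain ⟨w, h1, h2⟩ := hg.exists_between x z hR0 h
      exact mem_cthickening_of_dist_le z w δ _ (by simp [dist_comm, h1])
        (by rw [dist_comm]; linarith)
  linarith [le_csSup hbdd hmem]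

theorem sphere_subset_frontier_ball (hg : GeodesicMetricSpace X) (p : X) {t : ℝ} (ht : 0 < t) :
    sphere p t ⊆ frontier (ball p t) := by
  intro z hz
  rw [mem_sphere, dist_comm] at hz
  rw [frontier, isOpen_ball.interior_eq]
  refine ⟨Metric.mem_closure_iff.2 fun ε hε => ?_, by simp [dist_comm, hz]⟩
  obtain ⟨w, h1, h2⟩ := hg.exists_between p z (r := max 0 (t - ε / 2)) (le_max_left _ _)
    (by rw [hz]; exact max_le ht.le (by linarith))
  refine ⟨w, ?_, ?_⟩
  · rw [mem_ball, dist_comm, h1]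
    exact max_lt ht (by linarith)
  · rw [dist_comm, h2, hz]
    linarith [le_max_right 0 (t - ε / 2)]

theorem frontier_ball_nonempty (hg : GeodesicMetricSpace X) [CompleteSpace X]
    [LocallyCompactSpace X] (hX : ¬ CompactSpace X) (p : X) {t : ℝ} (ht : 0 < t) :
    (frontier (ball p t)).Nonempty := by
  obtain ⟨y, hy⟩ : ∃ y, t < dist p y := by
    by_contra! h
    refine hX ⟨?_⟩
    convert hg.isCompact_closedBall p t
    refine (eq_univ_of_forall fun y => ?_).symm
    simpa [dist_comm] using h y
  obtain ⟨w, hw, -⟩ := hg.exists_between p y ht.le hy.le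
  exact ⟨w, hg.sphere_subset_frontier_ball p ht (by simp [dist_comm, hw])⟩

theorem infDist_frontier_ball_sub_mono (hg : GeodesicMetricSpace X) {p x : X} {s t : ℝ}
    (hs : 0 < s) (hx : dist p x ≤ s) (hst : s ≤ t) (hne : (frontier (ball p t)).Nonempty) :
    infDist x (frontier (ball p s)) - s ≤ infDist x (frontier (ball p t)) - t := by
  suffices h : infDist x (frontier (ball p s)) + (t - s) ≤ infDist x (frontier (ball p t)) by
    linarith
  refine (le_infDist hne).2 fun y hy => ?_
  have hy' : dist p y = t := by
    rw [dist_comm]; exact frontier_ball_subset_sphere hy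
  obtain ⟨γ, h1, h2, h3⟩ := hg x y
  have hcont : ContinuousOn (fun r => dist p (γ r)) (Set.Icc 0 (dist x y)) :=
    (continuous_const.dist continuous_id).comp_continuousOn h3.continuousOn
  obtain ⟨r, hr, hrs⟩ := intermediate_value_Icc dist_nonneg hcont
    (show s ∈ Set.Icc (dist p (γ 0)) (dist p (γ (dist x y))) by
      rw [h1, h2, hy']; exact ⟨hx, hst⟩)
  have hz : γ r ∈ frontier (ball p s) :=
    hg.sphere_subset_frontier_ball p hs (by simpa [dist_comm] using hrs)
  have hxz : dist x (γ r) = r := by simpa [h1] using h3.dist_left hr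
  have hzy : dist (γ r) y = dist x y - r := by simpa [h2] using h3.dist_right hr
  have hle := infDist_le_dist_of_mem (x := x) hz
  have htri := dist_triangle p (γ r) y
  simp only at hrs
  linarith

theorem tendsto_busemann (hg : GeodesicMetricSpace X) [CompleteSpace X]
    [LocallyCompactSpace X] (hX : ¬ CompactSpace X) (p x : X) :
    Tendsto (fun t : ℝ => infDist x (frontier (ball p t)) - t) atTop (𝓝 (busemann p x)) := by
  set T := dist p x + 1 with hT
  have hT0 : 0 < T := by positivity
  set g : ℝ → ℝ := fun t => infDist x (frontier (ball p (max T t))) - max T t with hgdef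
  have hmono : Monotone g := fun s t hst =>
    hg.infDist_frontier_ball_sub_mono (hT0.trans_le (le_max_left _ _))
      (le_trans (by linarith) (le_max_left T s)) (max_le_max le_rfl hst)
      (hg.frontier_ball_nonempty hX p (hT0.trans_le (le_max_left _ _)))
  have hbdd : BddAbove (range g) := by
    refine ⟨dist p x, ?_⟩
    rintro _ ⟨t, rfl⟩
    obtain ⟨y, hy⟩ := hg.frontier_ball_nonempty hX p (hT0.trans_le (le_max_left T t))
    have hy' : dist p y = max T t := by
      rw [dist_comm]; exact frontier_ball_subset_sphere hy
    have := infDist_le_dist_of_mem (x := x) hy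
    simp only [hgdef]
    linarith [dist_triangle x p y, dist_comm x p]
  have hlim : Tendsto (fun t : ℝ => infDist x (frontier (ball p t)) - t) atTop (𝓝 (⨆ t, g t)) := by
    refine (tendsto_atTop_ciSup hmono hbdd).congr' ?_
    filter_upwards [eventually_ge_atTop T] with t ht
    simp only [hgdef, max_eq_right ht]
  rw [busemann, hlim.limUnder_eq]
  exact hlim

theorem busemann_le_add_dist (hg : GeodesicMetricSpace X) [CompleteSpace X]
    [LocallyCompactSpace X] (hX : ¬ CompactSpace X) (p x y : X) :
    busemann p x ≤ busemann p y + dist x y := by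
  refine le_of_tendsto_of_tendsto' (hg.tendsto_busemann hX p x)
    ((hg.tendsto_busemann hX p y).add_const _) fun t => ?_
  have := infDist_le_infDist_add_dist (s := frontier (ball p t)) (x := x) (y := y)
  linarith

/-- The functions approximating the Busemann function converge uniformly from below
on compact sets. -/
theorem eventually_busemann_sub_lt (hg : GeodesicMetricSpace X) [CompleteSpace X]
    [LocallyCompactSpace X] (hX : ¬ CompactSpace X) (p : X) {K : Set X} (hK : IsCompact K)
    {ε : ℝ} (hε : 0 < ε) :
    ∀ᶠ t in atTop, ∀ q ∈ K, busemann p q - ε < infDist q (frontier (ball p t)) - t := by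
  refine hK.induction_on (p := fun s => ∀ᶠ t in atTop, ∀ q ∈ s,
    busemann p q - ε < infDist q (frontier (ball p t)) - t) ?_ ?_ ?_ ?_
  · simp
  · intro s t hst h
    filter_upwards [h] with r hr q hq using hr q (hst hq)
  · intro s t hs ht
    filter_upwards [hs, ht] with r h1 h2 q hq using hq.elim (h1 q) (h2 q)
  · intro z _
    refine ⟨ball z (ε / 3), mem_nhdsWithin_of_mem_nhds (ball_mem_nhds z (by linarith)), ?_⟩
    filter_upwards [(hg.tendsto_busemann hX p z).eventually_const_lt
      (show busemann p z - ε / 3 < busemann p z by linarith)] with t ht q hq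
    rw [mem_ball] at hq
    have h1 := hg.busemann_le_add_dist hX p q z
    have h2 := infDist_le_infDist_add_dist (s := frontier (ball p t)) (x := z) (y := q)
    rw [dist_comm z q] at h2
    linarith

end GeodesicMetricSpace

namespace CurvGE

variable {X : Type u} [MetricSpace X]

theorem comparisonAngle_zero (p a b : X) : comparisonAngle 0 p a b =
    Real.arccos ((dist p a ^ 2 + dist p b ^ 2 - dist a b ^ 2) / (2 * dist p a * dist p b)) := by
  simp [comparisonAngle]

theorem comparisonAngle_zero_nonneg (p a b : X) : 0 ≤ comparisonAngle 0 p a b := by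
  rw [comparisonAngle_zero]
  exact Real.arccos_nonneg _

theorem neg_one_le_cosine {p a b : X} (ha : p ≠ a) (hb : p ≠ b) :
    -1 ≤ (dist p a ^ 2 + dist p b ^ 2 - dist a b ^ 2) / (2 * dist p a * dist p b) := by
  have h1 := dist_pos.2 ha
  have h2 := dist_pos.2 hb
  rw [le_div_iff₀ (by positivity)]
  nlinarith [dist_triangle a p b, dist_comm a p, dist_nonneg (x := a) (y := b)]

theorem cosine_le_one {p a b : X} (ha : p ≠ a) (hb : p ≠ b) :
    (dist p a ^ 2 + dist p b ^ 2 - dist a b ^ 2) / (2 * dist p a * dist p b) ≤ 1 := by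
  have h1 := dist_pos.2 ha
  have h2 := dist_pos.2 hb
  rw [div_le_one (by positivity)]
  have h3 : |dist p a - dist p b| ≤ dist a b := by
    simpa [dist_comm] using abs_dist_sub_le a b p
  nlinarith [sq_le_sq' (by linarith [neg_abs_le (dist p a - dist p b)])
    ((le_abs_self _).trans h3)]

/-- In nonnegative curvature a geodesic triangle is at least as fat as its Euclidean comparison
triangle (with Stewart's formula giving the Euclidean distance). -/
theorem stewart (hc : CurvGE X 0) {γ : ℝ → X} {L : ℝ} (hγ : IsMinGeodesicOn γ 0 L) (b : X)
    {s : ℝ} (hs : s ∈ Set.Icc 0 L) :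
    (L - s) * dist (γ 0) b ^ 2 + s * dist (γ L) b ^ 2 - s * (L - s) * L ≤
      L * dist (γ s) b ^ 2 := by
  rcases hs.1.eq_or_lt with rfl | hs0
  · simp
  rcases hs.2.eq_or_lt with rfl | hsL
  · simp
  have h1 : dist (γ s) (γ 0) = s := by simpa [dist_comm] using hγ.dist_left hs
  have h2 : dist (γ s) (γ L) = L - s := hγ.dist_right hs
  have h3 : dist (γ 0) (γ L) = L := by
    simpa using hγ.dist_left (t := L) ⟨hs.1.trans hs.2, le_rfl⟩
  by_cases hb : γ s = b
  · subst hb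
    rw [dist_comm (γ 0), dist_comm (γ L), h1, h2, dist_self]
    nlinarith
  have hx : γ s ≠ γ 0 := dist_pos.1 (by rw [h1]; exact hs0)
  have hy : γ s ≠ γ L := dist_pos.1 (by rw [h2]; linarith)
  have hw : 0 < dist (γ s) b := dist_pos.2 hb
  have hq := hc (γ s) (mem_univ _) (γ 0) (mem_univ _) (γ L) (mem_univ _) b (mem_univ _) hx hy hb
  have hpi : comparisonAngle 0 (γ s) (γ 0) (γ L) = Real.pi := by
    rw [comparisonAngle_zero, h1, h2, h3, ← Real.arccos_neg_one]
    congr 1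
    rw [div_eq_iff (mul_pos (mul_pos two_pos hs0) (sub_pos.2 hsL)).ne']
    ring
  have hle : comparisonAngle 0 (γ s) b (γ 0) ≤ Real.pi - comparisonAngle 0 (γ s) (γ L) b := by
    linarith
  have hcos := Real.cos_le_cos_of_nonneg_of_le_pi (comparisonAngle_zero_nonneg _ _ _)
    (sub_le_self _ (comparisonAngle_zero_nonneg _ _ _)) hle
  rw [Real.cos_pi_sub, comparisonAngle_zero, comparisonAngle_zero,
    Real.cos_arccos (neg_one_le_cosine hy hb) (cosine_le_one hy hb),
    Real.cos_arccos (neg_one_le_cosine hb hx) (cosine_le_one hb hx), h1, h2, dist_comm b,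
    neg_le_iff_add_nonneg, div_add_div _ _ (by positivity)
      (mul_pos (mul_pos two_pos (sub_pos.2 hsL)) hw).ne'] at hcos
  have hpos : 0 < 2 * dist (γ s) b * s * (2 * (L - s) * dist (γ s) b) :=
    mul_pos (by positivity) (mul_pos (mul_pos two_pos (sub_pos.2 hsL)) hw)
  have hnum := (le_div_iff₀ hpos).1 hcos
  rw [zero_mul] at hnum
  have hfac : 0 ≤ 2 * dist (γ s) b * (L * dist (γ s) b ^ 2 - ((L - s) * dist (γ 0) b ^ 2 +
      s * dist (γ L) b ^ 2 - s * (L - s) * L)) := by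
    refine hnum.trans_eq ?_
    ring
  have := (mul_nonneg_iff_of_pos_left (mul_pos two_pos hw)).1 hfac
  linarith

/-- Monotonicity of the comparison cosine along one side of a hinge. -/
theorem hinge_mono (hc : CurvGE X 0) {γ : ℝ → X} {L : ℝ} (hγ : IsMinGeodesicOn γ 0 L) (b : X)
    {s : ℝ} (hs : s ∈ Set.Icc 0 L) :
    L * (s ^ 2 + dist (γ 0) b ^ 2 - dist (γ s) b ^ 2) ≤
      s * (L ^ 2 + dist (γ 0) b ^ 2 - dist (γ L) b ^ 2) := by
  have := hc.stewart hγ b hs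
  linarith

/-- If a hinge has obtuse comparison angle, then it is obtuse. -/
theorem pi_div_two_lt_angleAt (hc : CurvGE X 0) {x : X} (γ σ : GeodesicRayFrom x)
    (h : γ.len ^ 2 + σ.len ^ 2 < dist (γ.toFun γ.len) (σ.toFun σ.len) ^ 2) :
    Real.pi / 2 < angleAt x γ.toFun σ.toFun := by
  set c := (γ.len ^ 2 + σ.len ^ 2 - dist (γ.toFun γ.len) (σ.toFun σ.len) ^ 2) /
    (2 * γ.len * σ.len) with hcdef
  have hL := γ.len_pos
  have hM := σ.len_pos
  have hc0 : c < 0 := div_neg_of_neg_of_pos (by linarith) (by positivity)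
  have hcmul : γ.len ^ 2 + σ.len ^ 2 - dist (γ.toFun γ.len) (σ.toFun σ.len) ^ 2 =
      c * (2 * γ.len * σ.len) := by
    rw [hcdef, div_mul_cancel₀ _ (by positivity)]
  have hlt : Real.pi / 2 < Real.arccos c := by
    rw [← not_le, Real.arccos_le_pi_div_two, not_le]
    exact hc0
  refine hlt.trans_le (le_limsup_of_frequently_le (Eventually.frequently ?_) ?_)
  · filter_upwards [prod_mem_prod (Ioc_mem_nhdsGT hL) (Ioc_mem_nhdsGT hM)]
    rintro ⟨s, t⟩ ⟨hs, ht⟩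
    simp only at hs ht
    have hs' : s ∈ Set.Icc 0 γ.len := ⟨hs.1.le, hs.2⟩
    have ht' : t ∈ Set.Icc 0 σ.len := ⟨ht.1.le, ht.2⟩
    have e1 : dist x (γ.toFun s) = s := by simpa [γ.source] using γ.geodesic.dist_left hs'
    have e2 : dist x (σ.toFun t) = t := by simpa [σ.source] using σ.geodesic.dist_left ht'
    have e3 : dist x (γ.toFun γ.len) = γ.len := by
      simpa [γ.source] using γ.geodesic.dist_left ⟨hL.le, le_rfl⟩
    have m1 := hc.hinge_mono γ.geodesic (σ.toFun t) hs'
    have m2 := hc.hinge_mono σ.geodesic (γ.toFun γ.len) ht'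
    rw [γ.source, e2] at m1
    rw [σ.source, e3, dist_comm (σ.toFun t), dist_comm (σ.toFun σ.len)] at m2
    rw [comparisonAngle_zero, e1, e2]
    refine Real.arccos_le_arccos ((div_le_iff₀ (mul_pos (mul_pos two_pos hs.1) ht.1)).2 ?_)
    have m3 := mul_le_mul_of_nonneg_left m1 hM.le
    have m4 := mul_le_mul_of_nonneg_left m2 hs.1.le
    refine le_of_mul_le_mul_left ?_ (mul_pos hL hM)
    calc γ.len * σ.len * (s ^ 2 + t ^ 2 - dist (γ.toFun s) (σ.toFun t) ^ 2)
        ≤ s * t * (γ.len ^ 2 + σ.len ^ 2 - dist (γ.toFun γ.len) (σ.toFun σ.len) ^ 2) := by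
          linarith
      _ = γ.len * σ.len * (c * (2 * s * t)) := by rw [hcmul]; ring
  · refine isBoundedUnder_of ⟨Real.pi, fun st => ?_⟩
    rw [comparisonAngle_zero]
    exact Real.arccos_le_pi _

end CurvGE

theorem GeodesicMetricSpace.exists_ray {X : Type u} [MetricSpace X]
    (hg : GeodesicMetricSpace X) {x y : X} (hxy : x ≠ y) :
    ∃ γ : GeodesicRayFrom x, γ.len = dist x y ∧ γ.toFun γ.len = y := by
  obtain ⟨γ, h1, h2, h3⟩ := hg x y
  exact ⟨⟨γ, dist x y, dist_pos.2 hxy, h1, h3⟩, rfl, h2⟩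

/-- (Cao–Ge). On an open nonnegatively curved Alexandrov space, for any subset `A` of the
maximum set `Ω(0)` of the Busemann function, the distance function `d(·, A)` has no
critical point outside `Ω(0)`. -/
theorem no_critical_point_outside_omega0 {n : ℕ} {X : Type u} [MetricSpace X]
    (hX : IsAlexandrov X n 0) (hnoncompact : ¬ CompactSpace X) (p : X)
    (A : Set X) (hA : A ⊆ maxSet (busemann p))
    (x : X) (hx : x ∉ maxSet (busemann p)) :
    ¬ IsCriticalPt A x := by
  rintro ⟨-, hcrit⟩
  have hg := hX.geodesic
  have := hX.complete
  have := hX.locallyCompact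
  obtain ⟨y₀, hy₀⟩ : ∃ y, busemann p x < busemann p y := by
    simpa [maxSet] using hx
  obtain ⟨γ₀, -⟩ := hg.exists_ray (x := x) (y := y₀) (by rintro rfl; exact hy₀.false)
  obtain ⟨σ₀, ⟨-, hd⟩, -⟩ := hcrit γ₀
  set d := infDist x A with hddef
  have hd0 : 0 < d := hd ▸ σ₀.len_pos
  set e := (busemann p y₀ - busemann p x) / 4 with he
  have he0 : 0 < e := by linarith
  have hev := hg.eventually_busemann_sub_lt hnoncompact p (hg.isCompact_closedBall x d)
    (mul_pos two_pos he0)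
  have hevx := (hg.tendsto_busemann hnoncompact p x).eventually_lt_const
    (show busemann p x < busemann p x + e / 2 by linarith)
  obtain ⟨t, h1, h2, h3⟩ := (hev.and (hevx.and
    (eventually_gt_atTop (dist p x + d ^ 2 / e)))).exists
  have ht0 : 0 < t := lt_of_le_of_lt (by positivity) h3
  have hne := hg.frontier_ball_nonempty hnoncompact p ht0
  obtain ⟨y, hy, hxy⟩ := (infDist_lt_iff hne).1
    (show infDist x (frontier (ball p t)) < infDist x (frontier (ball p t)) + e / 2 by linarith)
  have hpy : dist p y = t := by
    rw [dist_comm]; exact frontier_ball_subset_sphere hy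
  have hfar : d ^ 2 / e < dist x y := by linarith [dist_triangle p x y]
  obtain ⟨γ, hlen, hend⟩ := hg.exists_ray (x := x) (y := y)
    (dist_pos.1 (lt_of_le_of_lt (by positivity) hfar))
  obtain ⟨σ, ⟨hσA, hσd⟩, hangle⟩ := hcrit γ
  refine hangle.not_gt (hX.curv.pi_div_two_lt_angleAt γ σ ?_)
  set q := σ.toFun σ.len with hq
  have hxq : dist x q = d := by
    have h := σ.geodesic.dist_left (t := σ.len) ⟨σ.len_pos.le, le_rfl⟩
    rw [σ.source, sub_zero] at h
    exact h.trans hσd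
  have hbq : busemann p y₀ ≤ busemann p q := hA hσA y₀
  have hq1 := h1 q (by rw [mem_closedBall, dist_comm, hxq])
  have hq2 := infDist_le_dist_of_mem (x := q) hy
  have hlong : dist x y + e ≤ dist y q := by
    rw [dist_comm y q]; linarith
  rw [hend, hlen, hσd]
  rw [div_lt_iff₀ he0] at hfar
  nlinarith [dist_nonneg (x := x) (y := y)]

end
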